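/- arXiv:2303.08217 — 3 statements merged into one kernel-verified Lean document; each statement's English description precedes it below -/
import Mathlib

section
/- Let ρ : B_b → [0,1] be a default risk measure. Then the following are equivalent: (i) ρ is scaling invariant and ρ(X) = inf_{ε>0} ρ(X + ε·𝟙_{X>0}) for all X ∈ B_b with X ≥ 0; (ii) ρ is illiquidity invariant; (iii) ρ(X) = ρ(𝟙_{X>0}) for all X ∈ B_b with X ≥ 0. -/
open MeasureTheory Filter Topology

/-- The set of bounded measurable functions `Ω → ℝ`. -/
def Bb (Ω : Type*) [MeasurableSpace Ω] : Set (Ω → ℝ) :=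
  {X | Measurable X ∧ ∃ M : ℝ, ∀ ω, |X ω| ≤ M}

/-- A default risk measure on a set `C` of bounded measurable functions:
it takes values in `[0,1]` on `C`, is monotone on `C`, vanishes at `0`,
and equals `1` on positive constants. -/
def IsDefaultRiskMeasure {Ω : Type*} [MeasurableSpace Ω]
    (C : Set (Ω → ℝ)) (ρ : (Ω → ℝ) → ℝ) : Prop :=
  (∀ X ∈ C, ρ X ∈ Set.Icc (0 : ℝ) 1) ∧
  (∀ X ∈ C, ∀ Y ∈ C, (∀ ω, X ω ≤ Y ω) → ρ X ≤ ρ Y) ∧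
  ρ (fun _ => 0) = 0 ∧
  (∀ m : ℝ, 0 < m → ρ (fun _ => m) = 1)

/-- A monetary risk measure on `Bb Ω`: monotone, normalized, cash additive. -/
def IsMonetaryRiskMeasure {Ω : Type*} [MeasurableSpace Ω] (R : (Ω → ℝ) → ℝ) : Prop :=
  (∀ X ∈ Bb Ω, ∀ Y ∈ Bb Ω, (∀ ω, X ω ≤ Y ω) → R X ≤ R Y) ∧
  R (fun _ => 0) = 0 ∧
  (∀ X ∈ Bb Ω, ∀ m : ℝ, R (fun ω => X ω + m) = R X + m)

/-- The `ρ`-value at risk at level `α`. -/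
noncomputable def VaR {Ω : Type*} [MeasurableSpace Ω]
    (ρ : (Ω → ℝ) → ℝ) (α : ℝ) (X : Ω → ℝ) : ℝ :=
  sInf {m : ℝ | ρ (fun ω => X ω - m) ≤ α}

/-- The indicator function of the default set `{X > 0}`. -/
noncomputable def indPos {Ω : Type*} (X : Ω → ℝ) : Ω → ℝ :=
  Set.indicator {ω | 0 < X ω} (fun _ => 1)

theorem indPos_of_pos {Ω : Type*} {X : Ω → ℝ} {ω : Ω} (h : 0 < X ω) : indPos X ω = 1 :=
  Set.indicator_of_mem (s := {ω | 0 < X ω}) h _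

theorem indPos_of_not_pos {Ω : Type*} {X : Ω → ℝ} {ω : Ω} (h : ¬ 0 < X ω) : indPos X ω = 0 :=
  Set.indicator_of_notMem (s := {ω | 0 < X ω}) h _

theorem indPos_nonneg {Ω : Type*} (X : Ω → ℝ) (ω : Ω) : 0 ≤ indPos X ω :=
  Set.indicator_nonneg (fun _ _ => zero_le_one) ω

theorem indPos_congr {Ω : Type*} {X Y : Ω → ℝ} (h : ∀ ω, 0 < X ω ↔ 0 < Y ω) :
    indPos X = indPos Y := by
  simp only [indPos, h]

theorem indPos_mem_Bb {Ω : Type*} [MeasurableSpace Ω] {X : Ω → ℝ} (hX : X ∈ Bb Ω) :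
    indPos X ∈ Bb Ω := by
  refine ⟨measurable_const.indicator (measurableSet_lt measurable_const hX.1), 1, fun ω => ?_⟩
  by_cases h : 0 < X ω
  · simp [indPos_of_pos h]
  · simp [indPos_of_not_pos h]

theorem const_mul_mem_Bb {Ω : Type*} [MeasurableSpace Ω] (c : ℝ) {X : Ω → ℝ} (hX : X ∈ Bb Ω) :
    (fun ω => c * X ω) ∈ Bb Ω := by
  obtain ⟨hm, M, hM⟩ := hX
  refine ⟨hm.const_mul c, |c| * M, fun ω => ?_⟩
  rw [abs_mul]
  exact mul_le_mul_of_nonneg_left (hM ω) (abs_nonneg c)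

theorem add_mem_Bb {Ω : Type*} [MeasurableSpace Ω] {X Y : Ω → ℝ} (hX : X ∈ Bb Ω)
    (hY : Y ∈ Bb Ω) : (fun ω => X ω + Y ω) ∈ Bb Ω := by
  obtain ⟨hm, M, hM⟩ := hX
  obtain ⟨hn, N, hN⟩ := hY
  exact ⟨hm.add hn, M + N, fun ω => (abs_add_le _ _).trans (add_le_add (hM ω) (hN ω))⟩

/-- A bounded function lies below a positive multiple of the indicator of its positivity set. -/
theorem exists_le_mul_indPos {Ω : Type*} [MeasurableSpace Ω] {X : Ω → ℝ} (hX : X ∈ Bb Ω) :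
    ∃ M : ℝ, 0 < M ∧ ∀ ω, X ω ≤ M * indPos X ω := by
  obtain ⟨-, M, hM⟩ := hX
  refine ⟨|M| + 1, by positivity, fun ω => ?_⟩
  by_cases h : 0 < X ω
  · rw [indPos_of_pos h]
    linarith [le_abs_self (X ω), hM ω, le_abs_self M]
  · rw [indPos_of_not_pos h]
    linarith

theorem indPos_pos_iff {Ω : Type*} {X : Ω → ℝ} {ω : Ω} : 0 < indPos X ω ↔ 0 < X ω := by
  by_cases h : 0 < X ω
  · simp [indPos_of_pos h, h]
  · simp [indPos_of_not_pos h, h]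

theorem indPos_indPos {Ω : Type*} (X : Ω → ℝ) : indPos (indPos X) = indPos X :=
  indPos_congr fun _ => indPos_pos_iff

theorem indPos_const_mul {Ω : Type*} {c : ℝ} (hc : 0 < c) (X : Ω → ℝ) :
    indPos (fun ω => c * X ω) = indPos X :=
  indPos_congr fun _ => mul_pos_iff_of_pos_left hc

theorem indPos_add_mul_indPos {Ω : Type*} {m : ℝ} (hm : 0 < m) (X : Ω → ℝ) :
    indPos (fun ω => X ω + m * indPos X ω) = indPos X := by
  refine indPos_congr fun ω => ?_
  by_cases h : 0 < X ω
  · simp only [indPos_of_pos h, h, iff_true]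
    linarith
  · simp [indPos_of_not_pos h]

/-- for a default risk measure the following are equivalent:
(i) scaling invariance together with the continuity property
`ρ(X) = inf_{ε>0} ρ(X + ε·𝟙_{X>0})` on nonnegative positions;
(ii) illiquidity invariance;
(iii) `ρ(X) = ρ(𝟙_{X>0})` for all nonnegative `X`. -/
theorem capacity_representation_nonneg {Ω : Type*} [MeasurableSpace Ω]
    (ρ : (Ω → ℝ) → ℝ) (hρ : IsDefaultRiskMeasure (Bb Ω) ρ) :
    (((∀ l : ℝ, 0 < l → ∀ X ∈ Bb Ω, (∀ ω, 0 ≤ X ω) →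
          ρ (fun ω => l * X ω) = ρ X) ∧
        (∀ X ∈ Bb Ω, (∀ ω, 0 ≤ X ω) →
          ρ X = sInf ((fun ε => ρ (fun ω => X ω + ε * indPos X ω)) '' Set.Ioi 0))) ↔
      (∀ m : ℝ, 0 < m → ∀ X ∈ Bb Ω, (∀ ω, 0 ≤ X ω) →
          ρ X = ρ (fun ω => X ω + m * indPos X ω))) ∧
    ((∀ m : ℝ, 0 < m → ∀ X ∈ Bb Ω, (∀ ω, 0 ≤ X ω) →
          ρ X = ρ (fun ω => X ω + m * indPos X ω)) ↔
      (∀ X ∈ Bb Ω, (∀ ω, 0 ≤ X ω) → ρ X = ρ (indPos X))) := by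
  have hmem : ∀ X ∈ Bb Ω, ∀ m : ℝ, (fun ω => X ω + m * indPos X ω) ∈ Bb Ω :=
    fun X hX m => add_mem_Bb hX (const_mul_mem_Bb m (indPos_mem_Bb hX))
  obtain ⟨-, hmono, -, -⟩ := hρ
  have illiquidity_of_indicator : (∀ X ∈ Bb Ω, (∀ ω, 0 ≤ X ω) → ρ X = ρ (indPos X)) →
      ∀ m : ℝ, 0 < m → ∀ X ∈ Bb Ω, (∀ ω, 0 ≤ X ω) →
        ρ X = ρ (fun ω => X ω + m * indPos X ω) := by
    intro h m hm X hX hX0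
    rw [h X hX hX0, h _ (hmem X hX m) fun ω =>
      add_nonneg (hX0 ω) (mul_nonneg hm.le (indPos_nonneg X ω)), indPos_add_mul_indPos hm]
  have indicator_of_illiquidity : (∀ m : ℝ, 0 < m → ∀ X ∈ Bb Ω, (∀ ω, 0 ≤ X ω) →
        ρ X = ρ (fun ω => X ω + m * indPos X ω)) →
      ∀ X ∈ Bb Ω, (∀ ω, 0 ≤ X ω) → ρ X = ρ (indPos X) := by
    intro h X hX hX0
    have hI := indPos_mem_Bb hX
    obtain ⟨M, hM, hle⟩ := exists_le_mul_indPos hX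
    apply le_antisymm
    · rw [h M hM _ hI (indPos_nonneg X)]
      refine hmono _ hX _ (hmem _ hI M) fun ω => ?_
      rw [indPos_indPos]
      linarith [hle ω, indPos_nonneg X ω]
    · rw [h 1 one_pos X hX hX0]
      exact hmono _ hI _ (hmem X hX 1) fun ω => by linarith [hX0 ω]
  refine ⟨⟨?_, fun h => ?_⟩, indicator_of_illiquidity, illiquidity_of_indicator⟩
  · rintro ⟨hscale, hinf⟩
    refine illiquidity_of_indicator fun X hX hX0 => ?_
    have hI := indPos_mem_Bb hX
    obtain ⟨M, hM, hle⟩ := exists_le_mul_indPos hX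
    apply le_antisymm
    · rw [← hscale M hM _ hI (indPos_nonneg X)]
      exact hmono _ hX _ (const_mul_mem_Bb M hI) hle
    · rw [hinf X hX hX0]
      refine le_csInf (Set.nonempty_Ioi.image _) ?_
      rintro _ ⟨ε, hε, rfl⟩
      rw [← hscale ε hε _ hI (indPos_nonneg X)]
      exact hmono _ (const_mul_mem_Bb ε hI) _ (hmem X hX ε) fun ω => by linarith [hX0 ω]
  · have hind := indicator_of_illiquidity h
    refine ⟨fun l hl X hX hX0 => ?_, fun X hX hX0 => ?_⟩
    · rw [hind X hX hX0, hind _ (const_mul_mem_Bb l hX) fun ω => mul_nonneg hl.le (hX0 ω),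
        indPos_const_mul hl]
    · have himage : (fun ε => ρ (fun ω => X ω + ε * indPos X ω)) '' Set.Ioi 0 = {ρ X} := by
        rw [← Set.Nonempty.image_const (Set.nonempty_Ioi (a := (0 : ℝ))) (ρ X)]
        exact Set.image_congr fun ε hε => (h ε hε X hX hX0).symm
      rw [himage, csInf_singleton]
end

section
/- Let ρ : B_b → [0,1] be a default risk measure with ρ(X) = ρ(𝟙_{X>0}) for all X ∈ B_b, and define the capacity c(A) := ρ(𝟙_A) for A ∈ ℱ. Then the following are equivalent: (i) ρ is continuous from below, i.e., ρ(X) = lim_{n→∞} ρ(X_n) for every sequence (X_n) ⊂ B_b with X_n ↗ X ∈ B_b pointwise; (ii) c(⋃_{n∈ℕ} A_n) = lim_{n→∞} c(A_n) for every nondecreasing sequence (A_n) ⊂ ℱ; (iii) ∫ X dc = lim_{n→∞} ∫ X_n dc for every sequence (X_n) ⊂ B_b with X_n ↗ X ∈ B_b pointwise, where for X ∈ B_b the Choquet integral is ∫ X dc := ∫_{−∞}^0 (c({X > s}) − 1) ds + ∫_0^∞ c({X > s}) ds. -/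
open MeasureTheory Filter Topology

/-- The capacity induced by a default risk measure: `c(A) = ρ(𝟙_A)`. -/
noncomputable def cap {Ω : Type*} (ρ : (Ω → ℝ) → ℝ) (A : Set Ω) : ℝ :=
  ρ (Set.indicator A (fun _ => 1))

/-- The Choquet integral of `X` with respect to the capacity induced by `ρ`:
`∫ X dc = ∫_{-∞}^0 (c({X > s}) - 1) ds + ∫_0^∞ c({X > s}) ds`. -/
noncomputable def choquet {Ω : Type*} (ρ : (Ω → ℝ) → ℝ) (X : Ω → ℝ) : ℝ :=
  (∫ s in Set.Iio (0 : ℝ), (cap ρ {ω | s < X ω} - 1)) +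
    ∫ s in Set.Ioi (0 : ℝ), cap ρ {ω | s < X ω}

lemma iUnion_superlevel {Ω : Type*} {X : Ω → ℝ} {Xn : ℕ → Ω → ℝ}
    (hmono : ∀ n ω, Xn n ω ≤ Xn (n + 1) ω)
    (hlim : ∀ ω, Tendsto (fun n => Xn n ω) atTop (𝓝 (X ω))) (s : ℝ) :
    ⋃ n, {ω | s < Xn n ω} = {ω | s < X ω} := by
  ext ω
  simp only [Set.mem_iUnion, Set.mem_ofPred_eq]
  exact ⟨fun ⟨n, hn⟩ =>
    hn.trans_le ((monotone_nat_of_le_succ fun n => hmono n ω).ge_of_tendsto (hlim ω) n),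
    fun h => ((hlim ω).eventually (lt_mem_nhds h)).exists⟩

section Capacity

variable {Ω : Type*} [MeasurableSpace Ω] {ρ : (Ω → ℝ) → ℝ}

lemma indicator_one_mem_Bb {A : Set Ω} (hA : MeasurableSet A) :
    A.indicator (fun _ => (1 : ℝ)) ∈ Bb Ω := by
  refine ⟨measurable_const.indicator hA, 1, fun ω => ?_⟩
  by_cases h : ω ∈ A <;> simp [h]

lemma IsDefaultRiskMeasure.cap_mem_Icc (hρ : IsDefaultRiskMeasure (Bb Ω) ρ) {A : Set Ω}
    (hA : MeasurableSet A) : cap ρ A ∈ Set.Icc (0 : ℝ) 1 :=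
  hρ.1 _ (indicator_one_mem_Bb hA)

lemma IsDefaultRiskMeasure.cap_mono (hρ : IsDefaultRiskMeasure (Bb Ω) ρ) {A B : Set Ω}
    (hA : MeasurableSet A) (hB : MeasurableSet B) (hAB : A ⊆ B) : cap ρ A ≤ cap ρ B :=
  hρ.2.1 _ (indicator_one_mem_Bb hA) _ (indicator_one_mem_Bb hB)
    (Set.indicator_le_indicator_of_subset hAB fun _ => zero_le_one)

lemma IsDefaultRiskMeasure.cap_empty (hρ : IsDefaultRiskMeasure (Bb Ω) ρ) :
    cap ρ (∅ : Set Ω) = 0 := by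
  rw [cap, Set.indicator_empty]
  exact hρ.2.2.1

lemma IsDefaultRiskMeasure.cap_univ (hρ : IsDefaultRiskMeasure (Bb Ω) ρ) :
    cap ρ (Set.univ : Set Ω) = 1 := by
  rw [cap, Set.indicator_univ]
  exact hρ.2.2.2 1 one_pos

lemma IsDefaultRiskMeasure.antitone_cap_superlevel (hρ : IsDefaultRiskMeasure (Bb Ω) ρ)
    {X : Ω → ℝ} (hX : Measurable X) : Antitone fun s : ℝ => cap ρ {ω | s < X ω} :=
  fun _ _ hst => hρ.cap_mono (measurableSet_lt measurable_const hX)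
    (measurableSet_lt measurable_const hX) fun _ hω => lt_of_le_of_lt hst hω

lemma IsDefaultRiskMeasure.choquet_indicator_one (hρ : IsDefaultRiskMeasure (Bb Ω) ρ)
    (A : Set Ω) : choquet ρ (A.indicator fun _ => 1) = cap ρ A := by
  have hneg : ∫ s in Set.Iio (0 : ℝ),
      (cap ρ {ω | s < A.indicator (fun _ => (1 : ℝ)) ω} - 1) = 0 := by
    refine setIntegral_eq_zero_of_forall_eq_zero fun s hs => ?_
    have : {ω | s < A.indicator (fun _ => (1 : ℝ)) ω} = Set.univ :=
      Set.eq_univ_of_forall fun ω =>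
        show s < A.indicator (fun _ => (1 : ℝ)) ω from
          lt_of_lt_of_le hs (Set.indicator_nonneg (fun _ _ => zero_le_one) ω)
    rw [this, hρ.cap_univ, sub_self]
  have hpos : ∫ s in Set.Ioi (0 : ℝ), cap ρ {ω | s < A.indicator (fun _ => (1 : ℝ)) ω} =
      ∫ s in Set.Ioi (0 : ℝ), (Set.Iio (1 : ℝ)).indicator (fun _ => cap ρ A) s := by
    refine setIntegral_congr_fun measurableSet_Ioi fun s hs => ?_
    have hs : 0 < s := hs
    by_cases h : s < 1
    · have : {ω | s < A.indicator (fun _ => (1 : ℝ)) ω} = A := by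
        ext ω
        by_cases hω : ω ∈ A <;> simp [hω, h, hs.le]
      simp [this, h]
    · have : {ω | s < A.indicator (fun _ => (1 : ℝ)) ω} = ∅ := by
        ext ω
        by_cases hω : ω ∈ A <;> simp [hω, not_lt.1 h, hs.le]
      simp [this, h, hρ.cap_empty]
  rw [choquet, hneg, hpos, setIntegral_indicator measurableSet_Iio, Set.Ioi_inter_Iio]
  simp

lemma tendsto_cap_superlevel
    (hc : ∀ A : ℕ → Set Ω, (∀ n, MeasurableSet (A n)) → (∀ n, A n ⊆ A (n + 1)) →
      Tendsto (fun n => cap ρ (A n)) atTop (𝓝 (cap ρ (⋃ n, A n))))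
    {X : Ω → ℝ} {Xn : ℕ → Ω → ℝ} (hXn : ∀ n, Measurable (Xn n))
    (hmono : ∀ n ω, Xn n ω ≤ Xn (n + 1) ω)
    (hlim : ∀ ω, Tendsto (fun n => Xn n ω) atTop (𝓝 (X ω))) (s : ℝ) :
    Tendsto (fun n => cap ρ {ω | s < Xn n ω}) atTop (𝓝 (cap ρ {ω | s < X ω})) := by
  rw [← iUnion_superlevel hmono hlim s]
  exact hc _ (fun n => measurableSet_lt measurable_const (hXn n))
    fun n ω hω => lt_of_lt_of_le hω (hmono n ω)

lemma IsDefaultRiskMeasure.tendsto_choquet (hρ : IsDefaultRiskMeasure (Bb Ω) ρ)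
    (hc : ∀ A : ℕ → Set Ω, (∀ n, MeasurableSet (A n)) → (∀ n, A n ⊆ A (n + 1)) →
      Tendsto (fun n => cap ρ (A n)) atTop (𝓝 (cap ρ (⋃ n, A n))))
    {X : Ω → ℝ} {Xn : ℕ → Ω → ℝ} (hXn : ∀ n, Xn n ∈ Bb Ω) (hX : X ∈ Bb Ω)
    (hmono : ∀ n ω, Xn n ω ≤ Xn (n + 1) ω)
    (hlim : ∀ ω, Tendsto (fun n => Xn n ω) atTop (𝓝 (X ω))) :
    Tendsto (fun n => choquet ρ (Xn n)) atTop (𝓝 (choquet ρ X)) := by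
  obtain ⟨a, ha⟩ := (hXn 0).2
  obtain ⟨b, hb⟩ := hX.2
  have hlow n ω : -a ≤ Xn n ω := (abs_le.1 (ha ω)).1.trans
    (monotone_nat_of_le_succ (fun n => hmono n ω) (Nat.zero_le n))
  have hup n ω : Xn n ω ≤ b :=
    ((monotone_nat_of_le_succ fun n => hmono n ω).ge_of_tendsto (hlim ω) n).trans
      (abs_le.1 (hb ω)).2
  have hcap s := tendsto_cap_superlevel hc (fun n => (hXn n).1) hmono hlim s
  have hmeas n : Measurable fun s : ℝ => cap ρ {ω | s < Xn n ω} :=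
    (hρ.antitone_cap_superlevel (hXn n).1).measurable
  have hIcc n (s : ℝ) : cap ρ {ω | s < Xn n ω} ∈ Set.Icc (0 : ℝ) 1 :=
    hρ.cap_mem_Icc (measurableSet_lt measurable_const (hXn n).1)
  have hbound (u v : ℝ) : Integrable ((Set.Icc u v).indicator fun _ => (1 : ℝ)) :=
    (integrable_indicator_iff measurableSet_Icc).2 (integrableOn_const (by simp))
  refine Tendsto.add ?_ ?_
  · refine tendsto_integral_of_dominated_convergence
      ((Set.Icc (-a) 0).indicator fun _ => (1 : ℝ))
      (fun n => ((hmeas n).sub_const 1).aestronglyMeasurable) (hbound _ _).integrableOn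
      (fun n => ?_) (ae_of_all _ fun s => (hcap s).sub_const 1)
    filter_upwards [ae_restrict_mem measurableSet_Iio] with s hs
    have hs : s < 0 := hs
    by_cases h : -a ≤ s
    · rw [Set.indicator_of_mem (Set.mem_Icc.2 ⟨h, hs.le⟩), Real.norm_eq_abs, abs_le]
      constructor <;> linarith [(hIcc n s).1, (hIcc n s).2]
    · have : {ω | s < Xn n ω} = Set.univ :=
        Set.eq_univ_of_forall fun ω => (not_le.1 h).trans_le (hlow n ω)
      simp [this, hρ.cap_univ, h]
  · refine tendsto_integral_of_dominated_convergence
      ((Set.Icc 0 b).indicator fun _ => (1 : ℝ))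
      (fun n => (hmeas n).aestronglyMeasurable) (hbound _ _).integrableOn
      (fun n => ?_) (ae_of_all _ hcap)
    filter_upwards [ae_restrict_mem measurableSet_Ioi] with s hs
    have hs : 0 < s := hs
    by_cases h : s ≤ b
    · rw [Set.indicator_of_mem (Set.mem_Icc.2 ⟨hs.le, h⟩), Real.norm_eq_abs,
        abs_of_nonneg (hIcc n s).1]
      exact (hIcc n s).2
    · have : {ω | s < Xn n ω} = ∅ :=
        Set.eq_empty_of_forall_notMem fun ω hω => h (le_of_lt hω |>.trans (hup n ω))
      simp [this, hρ.cap_empty, h]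

/-- A functional that is continuous from below on bounded measurable functions is continuous from
below along indicators of nondecreasing sequences of measurable sets. -/
lemma tendsto_indicator_of_continuous_from_below {F : (Ω → ℝ) → ℝ}
    (hF : ∀ (Xn : ℕ → Ω → ℝ) (X : Ω → ℝ), (∀ n, Xn n ∈ Bb Ω) → X ∈ Bb Ω →
      (∀ n ω, Xn n ω ≤ Xn (n + 1) ω) →
      (∀ ω, Tendsto (fun n => Xn n ω) atTop (𝓝 (X ω))) →
      Tendsto (fun n => F (Xn n)) atTop (𝓝 (F X)))
    {A : ℕ → Set Ω} (hA : ∀ n, MeasurableSet (A n)) (hmono : ∀ n, A n ⊆ A (n + 1)) :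
    Tendsto (fun n => F ((A n).indicator fun _ => 1)) atTop
      (𝓝 (F ((⋃ n, A n).indicator fun _ => 1))) :=
  hF _ _ (fun n => indicator_one_mem_Bb (hA n)) (indicator_one_mem_Bb (.iUnion hA))
    (fun n => Set.indicator_le_indicator_of_subset (hmono n) fun _ => zero_le_one)
    fun ω => ((monotone_nat_of_le_succ hmono).tendsto_indicator A _ ω).mono_right (pure_le_nhds _)

end Capacity

/-- for a default risk measure `ρ` with `ρ(X) = ρ(𝟙_{X>0})`, the
following are equivalent: (i) `ρ` is continuous from below; (ii) the induced
capacity is continuous from below; (iii) the Choquet integral is continuous from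
below. -/
theorem continuity_from_below_equiv {Ω : Type*} [MeasurableSpace Ω]
    (ρ : (Ω → ℝ) → ℝ) (hρ : IsDefaultRiskMeasure (Bb Ω) ρ)
    (hrep : ∀ X ∈ Bb Ω, ρ X = ρ (Set.indicator {ω | 0 < X ω} (fun _ => 1))) :
    ((∀ (Xn : ℕ → Ω → ℝ) (X : Ω → ℝ), (∀ n, Xn n ∈ Bb Ω) → X ∈ Bb Ω →
        (∀ n ω, Xn n ω ≤ Xn (n + 1) ω) →
        (∀ ω, Tendsto (fun n => Xn n ω) atTop (𝓝 (X ω))) →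
        Tendsto (fun n => ρ (Xn n)) atTop (𝓝 (ρ X))) ↔
      (∀ A : ℕ → Set Ω, (∀ n, MeasurableSet (A n)) →
        (∀ n, A n ⊆ A (n + 1)) →
        Tendsto (fun n => cap ρ (A n)) atTop (𝓝 (cap ρ (⋃ n, A n))))) ∧
    ((∀ A : ℕ → Set Ω, (∀ n, MeasurableSet (A n)) →
        (∀ n, A n ⊆ A (n + 1)) →
        Tendsto (fun n => cap ρ (A n)) atTop (𝓝 (cap ρ (⋃ n, A n)))) ↔
      (∀ (Xn : ℕ → Ω → ℝ) (X : Ω → ℝ), (∀ n, Xn n ∈ Bb Ω) → X ∈ Bb Ω →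
        (∀ n ω, Xn n ω ≤ Xn (n + 1) ω) →
        (∀ ω, Tendsto (fun n => Xn n ω) atTop (𝓝 (X ω))) →
        Tendsto (fun n => choquet ρ (Xn n)) atTop (𝓝 (choquet ρ X)))) := by
  refine ⟨⟨fun h A hA hmono => tendsto_indicator_of_continuous_from_below h hA hmono,
    fun hc Xn X hXn hX hmono hlim => ?_⟩,
    ⟨fun hc Xn X hXn hX hmono hlim => hρ.tendsto_choquet hc hXn hX hmono hlim,
    fun h A hA hmono => ?_⟩⟩
  · rw [hrep X hX, funext fun n => hrep (Xn n) (hXn n)]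
    exact tendsto_cap_superlevel hc (fun n => (hXn n).1) hmono hlim 0
  · simpa only [hρ.choquet_indicator_one] using
      tendsto_indicator_of_continuous_from_below h hA hmono
end

section
/- Let ℙ be a probability measure on ℱ, let C ⊆ B_b contain all constant functions and satisfy 𝟙_{X>0} ∈ C for all X ∈ C, and assume that C contains an ordered subset, i.e., writing P := { p ∈ [0,1] | ∃ X ∈ C with ℙ(X > 0) = p }, there exists a family (X_p)_{p∈P} ⊂ C with ℙ(X_p > 0) = p for all p ∈ P and {X_p > 0} ⊆ {X_q > 0} for all p, q ∈ P with p ≤ q. Let ρ : C → [0,1] be a default risk measure. Then the following are equivalent: (i) ρ is law-invariant with respect to ℙ and ρ(X) = ρ(𝟙_{X>0}) for all X ∈ C; (ii) there exists a nondecreasing distortion function T : [0,1] → [0,1] (i.e., T nondecreasing, T(0) = 0, T(1) = 1) such that ρ(X) = T(ℙ(X > 0)) for all X ∈ C. -/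
open MeasureTheory Filter Topology

/-- Indicators of measurable sets of equal measure have the same distribution. -/
theorem map_indicator_one_eq_of_measure_eq {Ω : Type*} [MeasurableSpace Ω]
    (P : Measure Ω) [IsFiniteMeasure P] {A B : Set Ω} (hA : MeasurableSet A)
    (hB : MeasurableSet B) (h : P A = P B) :
    Measure.map (A.indicator fun _ => (1 : ℝ)) P =
      Measure.map (B.indicator fun _ => (1 : ℝ)) P := by
  ext S hS
  have hc : P Aᶜ = P Bᶜ := by
    rw [measure_compl hA (measure_ne_top P A), measure_compl hB (measure_ne_top P B), h]
  rw [Measure.map_apply (measurable_const.indicator hA) hS,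
    Measure.map_apply (measurable_const.indicator hB) hS]
  classical
  by_cases h1 : (1 : ℝ) ∈ S <;> by_cases h0 : (0 : ℝ) ∈ S <;>
    simp [Set.indicator_const_preimage_eq_union, h1, h0, h, hc]

theorem measurableSet_pos_of_mem_Bb {Ω : Type*} [MeasurableSpace Ω] {X : Ω → ℝ}
    (hX : X ∈ Bb Ω) : MeasurableSet {ω | 0 < X ω} :=
  measurableSet_lt measurable_const hX.1

theorem setOf_pos_indicator_one {Ω : Type*} (A : Set Ω) :
    {ω | 0 < A.indicator (fun _ => (1 : ℝ)) ω} = A := by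
  ext ω
  by_cases h : ω ∈ A <;> simp [h]

/-- if `C` contains an ordered subset, then a default risk measure on
`C` is law-invariant and determined by the default set iff it is a distorted PD for
some nondecreasing distortion function `T`. -/
theorem lawInvariant_iff_monotone_distortedPD {Ω : Type*} [MeasurableSpace Ω]
    (P : Measure Ω) [IsProbabilityMeasure P]
    (C : Set (Ω → ℝ)) (hC : C ⊆ Bb Ω)
    (hconst : ∀ m : ℝ, (fun _ => m) ∈ C)
    (hind : ∀ X ∈ C, Set.indicator {ω | 0 < X ω} (fun _ => (1 : ℝ)) ∈ C)
    (hordered : ∃ Xp : ℝ → Ω → ℝ,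
      (∀ p ∈ {p : ℝ | ∃ X ∈ C, (P {ω | 0 < X ω}).toReal = p},
        Xp p ∈ C ∧ (P {ω | 0 < Xp p ω}).toReal = p) ∧
      (∀ p ∈ {p : ℝ | ∃ X ∈ C, (P {ω | 0 < X ω}).toReal = p},
        ∀ q ∈ {p : ℝ | ∃ X ∈ C, (P {ω | 0 < X ω}).toReal = p},
          p ≤ q → {ω | 0 < Xp p ω} ⊆ {ω | 0 < Xp q ω}))
    (ρ : (Ω → ℝ) → ℝ) (hρ : IsDefaultRiskMeasure C ρ) :
    ((∀ X ∈ C, ∀ Y ∈ C, Measure.map X P = Measure.map Y P → ρ X = ρ Y) ∧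
      (∀ X ∈ C, ρ X = ρ (Set.indicator {ω | 0 < X ω} (fun _ => 1)))) ↔
    (∃ T : ℝ → ℝ, T 0 = 0 ∧ T 1 = 1 ∧
      Set.MapsTo T (Set.Icc 0 1) (Set.Icc 0 1) ∧
      MonotoneOn T (Set.Icc 0 1) ∧
      ∀ X ∈ C, ρ X = T ((P {ω | 0 < X ω}).toReal)) := by
  constructor
  · rintro ⟨hlaw, hdef⟩
    obtain ⟨hmem, hmono, hzero, hone⟩ := hρ
    obtain ⟨Xp, hXp, hsub⟩ := hordered
    have heq : ∀ X ∈ C, ∀ Y ∈ C,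
        (P {ω | 0 < X ω}).toReal = (P {ω | 0 < Y ω}).toReal → ρ X = ρ Y := by
      intro X hX Y hY h
      rw [hdef X hX, hdef Y hY]
      exact hlaw _ (hind X hX) _ (hind Y hY) (map_indicator_one_eq_of_measure_eq P
        (measurableSet_pos_of_mem_Bb (hC hX)) (measurableSet_pos_of_mem_Bb (hC hY))
        ((ENNReal.toReal_eq_toReal_iff' (measure_ne_top _ _) (measure_ne_top _ _)).1 h))
    have hle : ∀ X ∈ C, ∀ Y ∈ C,
        (P {ω | 0 < X ω}).toReal ≤ (P {ω | 0 < Y ω}).toReal → ρ X ≤ ρ Y := by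
      intro X hX Y hY h
      obtain ⟨hp, hp'⟩ := hXp _ ⟨X, hX, rfl⟩
      obtain ⟨hq, hq'⟩ := hXp _ ⟨Y, hY, rfl⟩
      rw [← heq _ hp X hX hp', ← heq _ hq Y hY hq', hdef _ hp, hdef _ hq]
      exact hmono _ (hind _ hp) _ (hind _ hq) fun ω =>
        Set.indicator_le_indicator_of_subset (hsub _ ⟨X, hX, rfl⟩ _ ⟨Y, hY, rfl⟩ h)
          (fun _ => zero_le_one) ω
    let S : ℝ → Set ℝ := fun p => ρ '' {X | X ∈ C ∧ (P {ω | 0 < X ω}).toReal ≤ p}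
    have hbdd : ∀ p, BddAbove (S p) := by
      rintro p
      refine ⟨1, ?_⟩
      rintro _ ⟨X, ⟨hX, -⟩, rfl⟩
      exact (hmem X hX).2
    have hzero_mem : ∀ p, 0 ≤ p → 0 ∈ S p := fun p hp =>
      ⟨fun _ => 0, ⟨hconst 0, by simpa using hp⟩, hzero⟩
    have hT : ∀ X ∈ C, ρ X = sSup (S (P {ω | 0 < X ω}).toReal) := by
      intro X hX
      refine (IsGreatest.csSup_eq (s := S _) ⟨⟨X, ⟨hX, le_rfl⟩, rfl⟩, ?_⟩).symm
      rintro _ ⟨Y, ⟨hY, h⟩, rfl⟩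
      exact hle Y hY X hX h
    refine ⟨fun p => sSup (S p), ?_, ?_, ?_, ?_, hT⟩
    · have h := hT _ (hconst 0)
      rw [hzero] at h
      simpa using h.symm
    · have h := hT _ (hconst 1)
      rw [hone 1 one_pos] at h
      simpa using h.symm
    · intro p hp
      refine ⟨le_csSup (hbdd p) (hzero_mem p hp.1), csSup_le ⟨0, hzero_mem p hp.1⟩ ?_⟩
      rintro _ ⟨X, ⟨hX, -⟩, rfl⟩
      exact (hmem X hX).2
    · intro p hp q _ hpq
      exact csSup_le_csSup (hbdd q) ⟨0, hzero_mem p hp.1⟩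
        (Set.image_mono fun X hX => ⟨hX.1, hX.2.trans hpq⟩)
  · rintro ⟨T, -, -, -, -, hT⟩
    refine ⟨fun X hX Y hY h => ?_, fun X hX => ?_⟩
    · have h' := congrArg (fun μ => μ (Set.Ioi (0 : ℝ))) h
      simp only [Measure.map_apply (hC hX).1 measurableSet_Ioi,
        Measure.map_apply (hC hY).1 measurableSet_Ioi] at h'
      rw [hT X hX, hT Y hY]
      exact congrArg (fun x => T x.toReal) h'
    · rw [hT X hX, hT _ (hind X hX), setOf_pos_indicator_one]
end
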